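/- Consider the loss function ℓ(θ;x) = (1/2)‖θ − x‖² on the unconstrained set C = ℝ^d with data domain of diameter S_g (so the total gradient sensitivity is S_g). Let D, D' be any neighboring datasets of size n from this domain, let 0 < η < 1, σ > 0, and let both chains start from the same initial parameter θ₀ ∈ ℝ^d and evolve as θ_{k+1} = θ_k − η∇L_D(θ_k) + √(2ησ²)Z_k and θ'_{k+1} = θ'_k − η∇L_{D'}(θ'_k) + √(2ησ²)Z_k with Z_k i.i.d. standard Gaussians on ℝ^d. Then for every K ∈ ℕ and α > 1, the α-Rényi divergence between the laws of θ_K and θ'_K satisfies R_α(θ_K‖θ'_K) ≤ (α·S_g²/((2−η)·σ²·n²))·(1 − e^{−((2−η)/2)·η·K}). -/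

import Mathlib

open MeasureTheory ProbabilityTheory Real

noncomputable section

variable {d : ℕ}

local notation "𝓔" => EuclideanSpace ℝ (Fin d)

/-- The standard Gaussian measure `N(0, I_d)` on `ℝ^d`. -/
def stdGaussian (d : ℕ) : Measure (EuclideanSpace ℝ (Fin d)) :=
  Measure.map (⇑(EuclideanSpace.equiv (Fin d) ℝ).symm)
    (Measure.pi fun _ : Fin d => gaussianReal 0 1)

/-- The `α`-Rényi divergence between two measures,
`R_α(ν‖ν') = (α−1)⁻¹ log ∫ (dν/dν')^α dν'`. -/
def renyiDiv {d : ℕ} (α : ℝ) (ν ν' : Measure (EuclideanSpace ℝ (Fin d))) : ℝ :=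
  (α - 1)⁻¹ * Real.log (∫ θ, (ν.rnDeriv ν' θ).toReal ^ α ∂ν')

/-- Two datasets of size `n` are neighboring if they differ in exactly one record. -/
def Neighboring {X : Type*} {n : ℕ} (A B : Fin n → X) : Prop :=
  ∃ i₀ : Fin n, ∀ i : Fin n, i ≠ i₀ → A i = B i

section StdGaussian

open scoped RealInnerProductSpace

instance isProbabilityMeasure_stdGaussian_euclidean (d : ℕ) :
    IsProbabilityMeasure (_root_.stdGaussian d) :=
  Measure.isProbabilityMeasure_map (by fun_prop)

/-- The complex Laplace transform of the standard Gaussian measure. -/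
lemma integral_cexp_sum_stdGaussian (c : Fin d → ℂ) :
    ∫ z, Complex.exp (∑ i, c i * (z i : ℂ)) ∂(_root_.stdGaussian d)
      = Complex.exp (∑ i, c i ^ 2 / 2) := by
  rw [_root_.stdGaussian, integral_map (by fun_prop) (by fun_prop)]
  have h1 (i : Fin d) :
      ∫ x : ℝ, Complex.exp (c i * (x : ℂ)) ∂(gaussianReal 0 1) = Complex.exp (c i ^ 2 / 2) := by
    simpa [complexMGF] using
      complexMGF_gaussianReal (p := gaussianReal 0 1) (X := id) (Measure.map_id) (c i)
  simp only [EuclideanSpace.equiv, PiLp.continuousLinearEquiv_symm_apply, Complex.exp_sum]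
  rw [integral_fintype_prod_eq_prod (fun i (x : ℝ) => Complex.exp (c i * (x : ℂ)))]
  simp [h1]

/-- The Laplace transform of the standard Gaussian measure along a complex combination of two
real directions. -/
lemma integral_cexp_inner_stdGaussian (v t : 𝓔) :
    ∫ z, Complex.exp ((⟪v, z⟫ : ℂ) + (⟪z, t⟫ : ℂ) * Complex.I) ∂(_root_.stdGaussian d)
      = Complex.exp ((‖v‖ ^ 2 / 2 : ℝ) + (⟪v, t⟫ : ℂ) * Complex.I - (‖t‖ ^ 2 / 2 : ℝ)) := by
  have h := integral_cexp_sum_stdGaussian fun i => (v i : ℂ) + (t i : ℂ) * Complex.I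
  have hsum : ∑ i, ((v i : ℂ) + (t i : ℂ) * Complex.I) ^ 2 / 2
      = ((‖v‖ ^ 2 / 2 : ℝ) + (⟪v, t⟫ : ℂ) * Complex.I - (‖t‖ ^ 2 / 2 : ℝ)) := by
    simp only [EuclideanSpace.real_norm_sq_eq, PiLp.inner_apply, RCLike.inner_apply, conj_trivial]
    push_cast
    rw [Finset.sum_div, Finset.sum_div, Finset.sum_mul, ← Finset.sum_add_distrib,
      ← Finset.sum_sub_distrib]
    refine Finset.sum_congr rfl fun i _ => ?_
    linear_combination (t i : ℂ) ^ 2 / 2 * Complex.I_sq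
  rw [hsum] at h
  rw [← h]
  refine integral_congr_ae (.of_forall fun z => ?_)
  simp only [PiLp.inner_apply, RCLike.inner_apply, conj_trivial]
  push_cast
  rw [Finset.sum_mul, ← Finset.sum_add_distrib]
  congr 1
  refine Finset.sum_congr rfl fun i _ => ?_
  ring

lemma charFun_stdGaussian_euclidean (t : 𝓔) :
    charFun (_root_.stdGaussian d) t = Complex.exp (-(‖t‖ ^ 2 / 2 : ℝ)) := by
  simpa [charFun_apply] using integral_cexp_inner_stdGaussian 0 t

lemma integral_exp_inner_stdGaussian (v : 𝓔) :
    ∫ z, Real.exp ⟪v, z⟫ ∂(_root_.stdGaussian d) = Real.exp (‖v‖ ^ 2 / 2) := by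
  have h := integral_cexp_inner_stdGaussian v 0
  simp only [inner_zero_right, Complex.ofReal_zero, zero_mul, add_zero, norm_zero, ne_eq,
    OfNat.ofNat_ne_zero, not_false_eq_true, zero_pow, zero_div, sub_zero,
    ← Complex.ofReal_exp, integral_complex_ofReal] at h
  exact_mod_cast h

lemma integrable_exp_inner_stdGaussian (v : 𝓔) :
    Integrable (fun z => Real.exp ⟪v, z⟫) (_root_.stdGaussian d) := by
  by_contra h
  have := integral_exp_inner_stdGaussian v
  rw [integral_undef h] at this
  exact (Real.exp_pos _).ne this

/-- Cameron–Martin formula for the standard Gaussian measure: exponential tilting is a shift. -/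
lemma map_add_const_stdGaussian (w : 𝓔) :
    (_root_.stdGaussian d).map (· + w) = (_root_.stdGaussian d).tilted fun z => ⟪w, z⟫ := by
  have := isProbabilityMeasure_tilted (integrable_exp_inner_stdGaussian w)
  have : IsProbabilityMeasure ((_root_.stdGaussian d).map (· + w)) :=
    Measure.isProbabilityMeasure_map (by fun_prop)
  refine Measure.ext_of_charFun (funext fun t => ?_)
  rw [charFun_map_add_const, charFun_stdGaussian_euclidean, charFun_apply, integral_tilted,
    integral_exp_inner_stdGaussian]
  have h (z : 𝓔) : (Real.exp ⟪w, z⟫ / Real.exp (‖w‖ ^ 2 / 2)) • Complex.exp (⟪z, t⟫ * Complex.I)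
      = Complex.exp (-(‖w‖ ^ 2 / 2 : ℝ)) *
        Complex.exp ((⟪w, z⟫ : ℂ) + (⟪z, t⟫ : ℂ) * Complex.I) := by
    rw [← Real.exp_sub, Complex.real_smul, Complex.ofReal_exp, ← Complex.exp_add,
      ← Complex.exp_add]
    push_cast
    ring_nf
  simp_rw [h]
  rw [integral_const_mul, integral_cexp_inner_stdGaussian, ← Complex.exp_add, ← Complex.exp_add]
  ring_nf

/-- The Rényi divergence between a shifted standard Gaussian and the standard Gaussian. -/
lemma renyiDiv_map_add_const_stdGaussian (w : 𝓔) {α : ℝ} (hα : 1 < α) :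
    renyiDiv α ((_root_.stdGaussian d).map (· + w)) (_root_.stdGaussian d)
      = α * ‖w‖ ^ 2 / 2 := by
  have hint : ∫ z, (((_root_.stdGaussian d).map (· + w)).rnDeriv (_root_.stdGaussian d) z).toReal
      ^ α ∂(_root_.stdGaussian d) = Real.exp ((α - 1) * (α * ‖w‖ ^ 2 / 2)) := by
    have hae : (fun z => (((_root_.stdGaussian d).map (· + w)).rnDeriv
        (_root_.stdGaussian d) z).toReal ^ α) =ᵐ[_root_.stdGaussian d]
        fun z => Real.exp (-(α * (‖w‖ ^ 2 / 2))) * Real.exp ⟪α • w, z⟫ := by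
      rw [map_add_const_stdGaussian]
      have hmeas : AEMeasurable (fun z : 𝓔 => ⟪w, z⟫) (_root_.stdGaussian d) := by fun_prop
      filter_upwards [rnDeriv_tilted_left_self hmeas] with z hz
      rw [hz, integral_exp_inner_stdGaussian, ← Real.exp_sub,
        ENNReal.toReal_ofReal (Real.exp_pos _).le, ← Real.exp_mul, ← Real.exp_add,
        real_inner_smul_left]
      ring_nf
    rw [integral_congr_ae hae, integral_const_mul, integral_exp_inner_stdGaussian, ← Real.exp_add,
      norm_smul, mul_pow, Real.norm_eq_abs, sq_abs]
    ring_nf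
  rw [renyiDiv, hint, Real.log_exp, inv_mul_cancel_left₀ (sub_pos.2 hα).ne']

end StdGaussian

/-- Rényi divergence is invariant under measurable embeddings. -/
lemma renyiDiv_map (α : ℝ) {f : 𝓔 → 𝓔} (hf : MeasurableEmbedding f) (μ ν : Measure 𝓔)
    [SigmaFinite μ] [SigmaFinite ν] :
    renyiDiv α (μ.map f) (ν.map f) = renyiDiv α μ ν := by
  rw [renyiDiv, renyiDiv, hf.integral_map]
  congr 2
  refine integral_congr_ae ?_
  filter_upwards [hf.rnDeriv_map μ ν] with z hz
  rw [hz]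

lemma renyiDiv_self (α : ℝ) (μ : Measure 𝓔) [IsProbabilityMeasure μ] : renyiDiv α μ μ = 0 := by
  have h : (fun z => (μ.rnDeriv μ z).toReal ^ α) =ᵐ[μ] fun _ => (1 : ℝ) := by
    filter_upwards [μ.rnDeriv_self] with z hz
    simp [hz]
  simp [renyiDiv, integral_congr_ae h]

/-- The isotropic Gaussian measure `N(m, r² I_d)`. -/
def isoGaussian (m : EuclideanSpace ℝ (Fin d)) (r : ℝ) : Measure (EuclideanSpace ℝ (Fin d)) :=
  (_root_.stdGaussian d).map fun z => m + r • z

instance isProbabilityMeasure_isoGaussian (m : 𝓔) (r : ℝ) :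
    IsProbabilityMeasure (isoGaussian m r) :=
  Measure.isProbabilityMeasure_map (by fun_prop)

lemma isoGaussian_zero (m : 𝓔) : isoGaussian m 0 = Measure.dirac m := by
  simp [isoGaussian]

lemma renyiDiv_isoGaussian (m m' : 𝓔) {r α : ℝ} (hr : r ≠ 0) (hα : 1 < α) :
    renyiDiv α (isoGaussian m r) (isoGaussian m' r) = α * ‖m - m'‖ ^ 2 / (2 * r ^ 2) := by
  have hf : MeasurableEmbedding fun z : 𝓔 => m' + r • z :=
    ((Homeomorph.smulOfNeZero r hr).trans (Homeomorph.addLeft m')).measurableEmbedding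
  have hshift : isoGaussian m r
      = ((_root_.stdGaussian d).map (· + r⁻¹ • (m - m'))).map fun z => m' + r • z := by
    rw [Measure.map_map hf.measurable (by fun_prop), isoGaussian]
    congr 1
    funext z
    simp only [Function.comp_apply, smul_add, smul_inv_smul₀ hr]
    abel
  have := Measure.isProbabilityMeasure_map (μ := _root_.stdGaussian d)
    (f := (· + r⁻¹ • (m - m'))) (by fun_prop)
  rw [hshift, isoGaussian, renyiDiv_map α hf, renyiDiv_map_add_const_stdGaussian _ hα, norm_smul,
    mul_pow, norm_inv, inv_pow, Real.norm_eq_abs, sq_abs]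
  field_simp

open scoped RealInnerProductSpace in
lemma charFun_isoGaussian (m t : 𝓔) (r : ℝ) :
    charFun (isoGaussian m r) t
      = Complex.exp ((⟪m, t⟫ : ℂ) * Complex.I - (r ^ 2 * ‖t‖ ^ 2 / 2 : ℝ)) := by
  have h : isoGaussian m r = ((_root_.stdGaussian d).map (r • ·)).map (m + ·) := by
    rw [Measure.map_map (by fun_prop) (by fun_prop), isoGaussian]
    rfl
  rw [h, charFun_map_const_add, charFun_map_smul, charFun_stdGaussian_euclidean,
    ← Complex.exp_add, norm_smul, mul_pow, Real.norm_eq_abs, sq_abs]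
  ring_nf

/-- One noisy gradient step on the squared loss sends an isotropic Gaussian to an isotropic
Gaussian. -/
lemma map_noisyStep_isoGaussian (m c : 𝓔) (η ρ : ℝ) {r r' : ℝ}
    (hr : r' ^ 2 = (1 - η) ^ 2 * r ^ 2 + ρ ^ 2) :
    ((isoGaussian m r).prod (_root_.stdGaussian d)).map
      (fun q => q.1 - η • (q.1 - c) + ρ • q.2) = isoGaussian (m - η • (m - c)) r' := by
  have hconv : ((isoGaussian m r).prod (_root_.stdGaussian d)).map
      (fun q => q.1 - η • (q.1 - c) + ρ • q.2)
      = isoGaussian (m - η • (m - c)) ((1 - η) * r) ∗ isoGaussian 0 ρ := by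
    have h1 : isoGaussian (m - η • (m - c)) ((1 - η) * r)
        = (isoGaussian m r).map fun x => x - η • (x - c) := by
      rw [isoGaussian, isoGaussian, Measure.map_map (by fun_prop) (by fun_prop)]
      congr 1
      funext z
      simp only [Function.comp_apply]
      module
    have h2 : isoGaussian (0 : 𝓔) ρ = (_root_.stdGaussian d).map (ρ • ·) := by
      simp [isoGaussian]
    rw [h1, h2, Measure.conv, Measure.map_prod_map _ _ (by fun_prop) (by fun_prop),
      Measure.map_map (by fun_prop) (by fun_prop)]
    rfl
  have : IsProbabilityMeasure (((isoGaussian m r).prod (_root_.stdGaussian d)).map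
      (fun q => q.1 - η • (q.1 - c) + ρ • q.2)) :=
    Measure.isProbabilityMeasure_map (by fun_prop)
  refine Measure.ext_of_charFun (funext fun t => ?_)
  rw [hconv, charFun_conv, charFun_isoGaussian, charFun_isoGaussian, charFun_isoGaussian,
    ← Complex.exp_add, hr]
  simp only [inner_zero_left]
  push_cast
  ring_nf

/-- The law of noisy gradient descent on the squared loss after `k` steps. -/
lemma law_noisyGD_eq_isoGaussian {η σ : ℝ} (hη : 0 < η) (hη1 : η < 1) (c θ₀ : 𝓔)
    (μ : ℕ → Measure 𝓔) (h0 : μ 0 = Measure.dirac θ₀)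
    (hrec : ∀ k, μ (k + 1) = ((μ k).prod (_root_.stdGaussian d)).map
      fun q => q.1 - η • (q.1 - c) + Real.sqrt (2 * η * σ ^ 2) • q.2) (k : ℕ) :
    μ k = isoGaussian (c + (1 - η) ^ k • (θ₀ - c))
      (Real.sqrt (2 * σ ^ 2 * (1 - ((1 - η) ^ k) ^ 2) / (2 - η))) := by
  have hpow (k : ℕ) : ((1 - η) ^ k) ^ 2 ≤ 1 :=
    pow_le_one₀ (pow_nonneg (by linarith) _) (pow_le_one₀ (by linarith) (by linarith))
  have hnonneg (k : ℕ) : 0 ≤ 2 * σ ^ 2 * (1 - ((1 - η) ^ k) ^ 2) / (2 - η) :=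
    div_nonneg (mul_nonneg (by positivity) (sub_nonneg.2 (hpow k))) (by linarith)
  induction k with
  | zero => simp [h0, isoGaussian_zero]
  | succ k ih =>
    have hη2 : 2 - η ≠ 0 := by linarith
    rw [hrec, ih, map_noisyStep_isoGaussian _ _ _ _
      (r' := Real.sqrt (2 * σ ^ 2 * (1 - ((1 - η) ^ (k + 1)) ^ 2) / (2 - η)))]
    · congr 1
      module
    · rw [Real.sq_sqrt (hnonneg _), Real.sq_sqrt (hnonneg _), Real.sq_sqrt (by positivity)]
      field_simp
      ring

/-- The exact Gaussian contraction factor is dominated by the exponential rate. -/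
lemma sq_mul_one_sub_pow_le_one_sub_exp {η : ℝ} (hη : 0 < η) (hη1 : η < 1) (K : ℕ) :
    (1 - η / 2) ^ 2 * (1 - (1 - η) ^ K) ≤ 1 - Real.exp (-((2 - η) / 2) * η * K) := by
  set x : ℝ := (2 - η) / 2 * η with hx
  have hx0 : 0 < x := by rw [hx]; nlinarith
  have hxη : x ≤ η := by rw [hx]; nlinarith
  have hexp_le : Real.exp (-x) ≤ 1 - x + x ^ 2 / 2 := by
    have h := Real.quadratic_le_exp_of_nonneg hx0.le
    rw [Real.exp_neg]
    refine inv_le_of_inv_le₀ (by nlinarith [sq_nonneg (x - 1)]) (le_trans ?_ h)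
    rw [inv_le_iff_one_le_mul₀ (by nlinarith [sq_nonneg (x - 1)])]
    nlinarith [sq_nonneg (x ^ 2)]
  have hstep : (1 - η / 2) ^ 2 * η ≤ 1 - Real.exp (-x) := by
    have : (1 - η / 2) ^ 2 * η = x * (1 - η / 2) := by rw [hx]; ring
    nlinarith
  have hle : 1 - η ≤ Real.exp (-x) := by linarith [Real.add_one_le_exp (-x)]
  have hE : Real.exp (-((2 - η) / 2) * η * K) = Real.exp (-x) ^ K := by
    rw [← Real.exp_nat_mul, hx]
    ring_nf
  have hgeom (a : ℝ) : 1 - a ^ K = (1 - a) * ∑ j ∈ Finset.range K, a ^ j :=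
    (mul_neg_geom_sum a K).symm
  rw [hE, hgeom, hgeom, sub_sub_cancel, ← mul_assoc]
  refine mul_le_mul hstep ?_ ?_ ?_
  · exact Finset.sum_le_sum fun j _ => pow_le_pow_left₀ (by linarith) hle j
  · exact Finset.sum_nonneg fun j _ => pow_nonneg (by linarith) j
  · exact sub_nonneg.2 (Real.exp_le_one_iff.2 (by linarith))

lemma norm_average_sub_average_le {n : ℕ} {Sg : ℝ} (D D' : Fin n → 𝓔)
    (hdiam : ∀ i, ‖D i - D' i‖ ≤ Sg) (h : Neighboring D D') :
    ‖(n : ℝ)⁻¹ • ∑ i, D i - (n : ℝ)⁻¹ • ∑ i, D' i‖ ≤ Sg / n := by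
  obtain ⟨i₀, h⟩ := h
  rw [← smul_sub, ← Finset.sum_sub_distrib,
    Finset.sum_eq_single i₀ (fun i _ hi => sub_eq_zero.2 (h i hi)) (by simp), norm_smul, norm_inv,
    Real.norm_natCast, inv_mul_eq_div]
  gcongr
  exact hdiam i₀

/-- Corollary: RDP guarantee of noisy GD on the `ℓ₂`-norm squared loss.
For the loss `ℓ(θ;x) = ½‖θ−x‖²` (so `∇L_D(θ) = θ − x̄_D`) on a data domain of diameter `S_g`,
for any neighboring datasets `D, D'` and any common start `θ₀`, the unconstrained noisy GD
chains satisfy, for every `K` and `α > 1`,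
`R_α(θ_K‖θ'_K) ≤ (α S_g²/((2−η)σ²n²))(1 − e^{−((2−η)/2)ηK})`. -/
theorem l2_squared_loss_rdp_upper_bound
    (n : ℕ) (hn : 1 ≤ n) (Sg η σ : ℝ)
    (hη : 0 < η) (hη1 : η < 1) (hσ : 0 < σ) (hSg : 0 ≤ Sg)
    -- the data domain has diameter at most `S_g`
    (A : Set 𝓔) (hAdiam : ∀ x ∈ A, ∀ y ∈ A, ‖x - y‖ ≤ Sg)
    (D D' : Fin n → 𝓔) (hD : ∀ i, D i ∈ A) (hD' : ∀ i, D' i ∈ A)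
    (hDD' : Neighboring D D')
    (θ₀ : 𝓔)
    -- the coupled unconstrained noisy GD chains, `∇L_D(θ) = θ − x̄_D`
    (ν : ℕ → Measure (𝓔 × 𝓔))
    (hν0 : ν 0 = Measure.dirac (θ₀, θ₀))
    (hrec : ∀ k : ℕ, ν (k + 1) = Measure.map
      (fun q : (𝓔 × 𝓔) × 𝓔 =>
        (q.1.1 - η • (q.1.1 - (n : ℝ)⁻¹ • ∑ i, D i) + Real.sqrt (2 * η * σ ^ 2) • q.2,
         q.1.2 - η • (q.1.2 - (n : ℝ)⁻¹ • ∑ i, D' i) + Real.sqrt (2 * η * σ ^ 2) • q.2))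
      ((ν k).prod (stdGaussian d))) :
    ∀ K : ℕ, ∀ α > (1:ℝ),
      renyiDiv α (Measure.map Prod.fst (ν K)) (Measure.map Prod.snd (ν K))
        ≤ α * Sg ^ 2 / ((2 - η) * σ ^ 2 * n ^ 2)
            * (1 - Real.exp (-((2 - η) / 2) * η * K)) := by
  intro K α hα
  set c := (n : ℝ)⁻¹ • ∑ i, D i
  set c' := (n : ℝ)⁻¹ • ∑ i, D' i
  have hprob (k : ℕ) : IsProbabilityMeasure (ν k) := by
    induction k with
    | zero => rw [hν0]; infer_instance
    | succ k ih => rw [hrec]; exact Measure.isProbabilityMeasure_map (by fun_prop)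
  have hfst := law_noisyGD_eq_isoGaussian (σ := σ) hη hη1 c θ₀ (fun k => (ν k).map Prod.fst)
    (by rw [hν0, Measure.map_dirac' measurable_fst]) fun k => by
      have h := Measure.map_prod_map (ν k) (_root_.stdGaussian d) measurable_fst measurable_id
      rw [Measure.map_id] at h
      rw [hrec, h, Measure.map_map (by fun_prop) (by fun_prop),
        Measure.map_map (by fun_prop) (by fun_prop)]
      rfl
  have hsnd := law_noisyGD_eq_isoGaussian (σ := σ) hη hη1 c' θ₀ (fun k => (ν k).map Prod.snd)
    (by rw [hν0, Measure.map_dirac' measurable_snd]) fun k => by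
      have h := Measure.map_prod_map (ν k) (_root_.stdGaussian d) measurable_snd measurable_id
      rw [Measure.map_id] at h
      rw [hrec, h, Measure.map_map (by fun_prop) (by fun_prop),
        Measure.map_map (by fun_prop) (by fun_prop)]
      rfl
  rw [hfst, hsnd]
  rcases Nat.eq_zero_or_pos K with rfl | hK
  · simp [isoGaussian_zero, renyiDiv_self]
  set p := (1 - η) ^ K with hp
  have hp0 : 0 < p := pow_pos (by linarith) K
  have hp1 : p < 1 := pow_lt_one₀ (by linarith) (by linarith) hK.ne'
  have hη2 : 0 < 2 - η := by linarith
  have hvar : 0 < 2 * σ ^ 2 * (1 - p ^ 2) / (2 - η) := by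
    have : 0 < 1 - p ^ 2 := by nlinarith
    positivity
  have hn0 : (0 : ℝ) < n := by exact_mod_cast hn
  have hmean : ‖c + p • (θ₀ - c) - (c' + p • (θ₀ - c'))‖ ≤ (1 - p) * (Sg / n) := by
    have : c + p • (θ₀ - c) - (c' + p • (θ₀ - c')) = (1 - p) • (c - c') := by module
    rw [this, norm_smul, Real.norm_of_nonneg (by linarith)]
    exact mul_le_mul_of_nonneg_left (norm_average_sub_average_le D D'
      (fun i => hAdiam _ (hD i) _ (hD' i)) hDD') (by linarith)
  rw [renyiDiv_isoGaussian _ _ (Real.sqrt_pos.2 hvar).ne' hα, Real.sq_sqrt hvar.le]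
  calc α * ‖c + p • (θ₀ - c) - (c' + p • (θ₀ - c'))‖ ^ 2
        / (2 * (2 * σ ^ 2 * (1 - p ^ 2) / (2 - η)))
      ≤ α * ((1 - p) * (Sg / n)) ^ 2 / (2 * (2 * σ ^ 2 * (1 - p ^ 2) / (2 - η))) := by
        gcongr
    _ = α * Sg ^ 2 / ((2 - η) * σ ^ 2 * n ^ 2) * ((1 - η / 2) ^ 2 * (1 - p) / (1 + p)) := by
        have h1 : 1 - p ≠ 0 := by linarith
        have h2 : 1 + p ≠ 0 := by linarith
        have h3 : 1 - p ^ 2 = (1 - p) * (1 + p) := by ring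
        rw [h3]
        field_simp
    _ ≤ α * Sg ^ 2 / ((2 - η) * σ ^ 2 * n ^ 2)
          * (1 - Real.exp (-((2 - η) / 2) * η * K)) := by
        refine mul_le_mul_of_nonneg_left ?_ (by positivity)
        refine le_trans (div_le_self ?_ (by linarith))
          (sq_mul_one_sub_pow_le_one_sub_exp hη hη1 K)
        exact mul_nonneg (sq_nonneg _) (by linarith)

end
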